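/- Let v : Ω → ℝ² be the velocity field obtained from a vorticity ω via the axisymmetric Biot–Savart law, and let 1 < m < 2 < ℓ < ∞. Then ‖v‖_{L^∞} ≤ C ‖ω‖_{L^m(Ω)}^α ‖ω‖_{L^ℓ(Ω)}^{1−α} with α = (m/2)·(ℓ−2)/(ℓ−m) ∈ (0,1). -/

import Mathlib

open MeasureTheory ENNReal

/-- The half-plane `Ω = (0,∞) × ℝ` with the planar measure `drdz`. -/
def Omega : Set (ℝ × ℝ) := Set.Ioi (0 : ℝ) ×ˢ (Set.univ : Set ℝ)

/-- The Euclidean norm on `ℝ³ = ℝ × ℝ × ℝ`. -/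
noncomputable def enorm3 (v : ℝ × ℝ × ℝ) : ℝ :=
  Real.sqrt (v.1 ^ 2 + v.2.1 ^ 2 + v.2.2 ^ 2)

/-- The cross product on `ℝ³ = ℝ × ℝ × ℝ`. -/
noncomputable def cross3 (a b : ℝ × ℝ × ℝ) : ℝ × ℝ × ℝ :=
  (a.2.1 * b.2.2 - a.2.2 * b.2.1, a.2.2 * b.1 - a.1 * b.2.2, a.1 * b.2.1 - a.2.1 * b.1)

/-- The axisymmetric vorticity vector field `ω(r,z) e_θ` associated with a scalar
vorticity `ω` on `Ω`. -/
noncomputable def vortVec (ω : ℝ × ℝ → ℝ) (y : ℝ × ℝ × ℝ) : ℝ × ℝ × ℝ :=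
  (-(y.2.1 / Real.sqrt (y.1 ^ 2 + y.2.1 ^ 2)) * ω (Real.sqrt (y.1 ^ 2 + y.2.1 ^ 2), y.2.2),
   (y.1 / Real.sqrt (y.1 ^ 2 + y.2.1 ^ 2)) * ω (Real.sqrt (y.1 ^ 2 + y.2.1 ^ 2), y.2.2),
   0)

/-- The velocity field recovered from the axisymmetric vorticity `ω` via the
Biot–Savart law `v(x) = (4π)⁻¹ ∫ (x-y) × (ω e_θ)(y) / |x-y|³ dy`. -/
noncomputable def biotSavart (ω : ℝ × ℝ → ℝ) (x : ℝ × ℝ × ℝ) : ℝ × ℝ × ℝ :=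
  (4 * Real.pi)⁻¹ • ∫ y, ((enorm3 (x - y))⁻¹ ^ 3) • cross3 (x - y) (vortVec ω y)

theorem volume_restrict_Omega :
    (volume : Measure (ℝ × ℝ)).restrict Omega = (volume.restrict (Set.Ioi 0)).prod volume := by
  rw [Omega, Measure.volume_eq_prod, ← Measure.prod_restrict, Measure.restrict_univ]

/-- Integration over `ℝ³` in cylindrical coordinates. -/
theorem lintegral_cylindrical {F : ℝ × ℝ × ℝ → ℝ≥0∞} (hF : Measurable F) :
    ∫⁻ y, F y = ∫⁻ θ in Set.Ioo (-Real.pi) Real.pi, ∫⁻ p in Omega,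
      ENNReal.ofReal p.1 * F (p.1 * Real.cos θ, p.1 * Real.sin θ, p.2) := by
  rw [← (volume_preserving_prodAssoc (α₁ := ℝ) (β₁ := ℝ) (γ₁ := ℝ)).lintegral_comp hF,
    Measure.volume_eq_prod (ℝ × ℝ) ℝ, lintegral_prod_symm' _ (by fun_prop)]
  have key : ∀ z : ℝ, ∫⁻ q : ℝ × ℝ, F (MeasurableEquiv.prodAssoc (q, z)) =
      ∫⁻ θ in Set.Ioo (-Real.pi) Real.pi, ∫⁻ r in Set.Ioi 0,
        ENNReal.ofReal r * F (r * Real.cos θ, r * Real.sin θ, z) := by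
    intro z
    rw [← lintegral_comp_polarCoord_symm, polarCoord_target, Measure.volume_eq_prod,
      ← Measure.prod_restrict, lintegral_prod_symm']
    · rfl
    · simp only [polarCoord_symm_apply, smul_eq_mul]
      exact (by fun_prop : Measurable fun p : ℝ × ℝ => ENNReal.ofReal p.1 *
        F (p.1 * Real.cos p.2, p.1 * Real.sin p.2, z))
  simp_rw [key]
  rw [lintegral_lintegral_swap]
  · refine lintegral_congr fun θ => ?_
    rw [volume_restrict_Omega, lintegral_prod_symm' _ (by fun_prop)]
  · refine Measurable.aemeasurable ?_
    exact Measurable.lintegral_prod_right' (f := fun w : (ℝ × ℝ) × ℝ => ENNReal.ofReal w.2 *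
      F (w.2 * Real.cos w.1.2, w.2 * Real.sin w.1.2, w.1.1)) (by fun_prop)

theorem sqrt_polar {r : ℝ} (hr : 0 < r) (θ : ℝ) :
    Real.sqrt ((r * Real.cos θ) ^ 2 + (r * Real.sin θ) ^ 2) = r := by
  rw [show (r * Real.cos θ) ^ 2 + (r * Real.sin θ) ^ 2 = r ^ 2 by
    linear_combination r ^ 2 * Real.sin_sq_add_cos_sq θ, Real.sqrt_sq hr.le]

theorem measurableSet_Omega : MeasurableSet Omega := measurableSet_Ioi.prod MeasurableSet.univ

/-- The map `y ↦ (r, z)` from Cartesian to meridional coordinates. -/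
noncomputable def meridional (y : ℝ × ℝ × ℝ) : ℝ × ℝ :=
  (Real.sqrt (y.1 ^ 2 + y.2.1 ^ 2), y.2.2)

theorem measurable_meridional : Measurable meridional := by
  unfold meridional; fun_prop

theorem meridional_cylindrical {p : ℝ × ℝ} (hp : p ∈ Omega) (θ : ℝ) :
    meridional (p.1 * Real.cos θ, p.1 * Real.sin θ, p.2) = p := by
  simp [meridional, sqrt_polar (show 0 < p.1 from hp.1)]

theorem quasiMeasurePreserving_meridional :
    Measure.QuasiMeasurePreserving meridional volume (volume.restrict Omega) := by
  refine ⟨measurable_meridional, Measure.AbsolutelyContinuous.mk fun N hN h0 => ?_⟩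
  rw [Measure.map_apply measurable_meridional hN,
    ← lintegral_indicator_one (measurable_meridional hN),
    lintegral_cylindrical (measurable_one.indicator (measurable_meridional hN))]
  refine (lintegral_congr fun θ => ?_).trans lintegral_zero
  rw [lintegral_eq_zero_iff' (by
    refine Measurable.aemeasurable (Measurable.mul (by fun_prop)
      ((measurable_one.indicator (measurable_meridional hN)).comp (by fun_prop))))]
  have h1 : ∀ᵐ p ∂(volume.restrict Omega), p ∉ N := measure_eq_zero_iff_ae_notMem.1 h0
  filter_upwards [h1, ae_restrict_mem measurableSet_Omega] with p hp hpO
  have : (p.1 * Real.cos θ, p.1 * Real.sin θ, p.2) ∉ meridional ⁻¹' N := by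
    simpa [meridional_cylindrical hpO] using hp
  simp [Set.indicator_of_notMem this]

/-- If an axisymmetric function is a.e. measurable on `ℝ³`, so is its profile on `Ω`. -/
theorem aemeasurable_of_comp_meridional {ω : ℝ × ℝ → ℝ}
    (h : AEMeasurable (fun y => ω (meridional y)) volume) :
    AEMeasurable ω (volume.restrict Omega) := by
  obtain ⟨g, hg, hωg⟩ := h
  obtain ⟨N, hsub, hN, h0⟩ := exists_measurable_superset_of_null hωg
  rw [← lintegral_indicator_one hN, lintegral_cylindrical (measurable_one.indicator hN)] at h0
  have hmeas : Measurable fun w : ℝ × ℝ × ℝ => ENNReal.ofReal w.2.1 *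
      N.indicator 1 (w.2.1 * Real.cos w.1, w.2.1 * Real.sin w.1, w.2.2) :=
    Measurable.mul (by fun_prop) ((measurable_one.indicator hN).comp (by fun_prop))
  rw [lintegral_eq_zero_iff (Measurable.lintegral_prod_right' hmeas)] at h0
  have hne : (ae (volume.restrict (Set.Ioo (-Real.pi) Real.pi))).NeBot := by
    rw [ae_neBot, Ne, Measure.restrict_eq_zero, Real.volume_Ioo]
    simp [Real.pi_pos]
  obtain ⟨θ, hθ⟩ := h0.exists
  replace hθ := (lintegral_eq_zero_iff (hmeas.comp (measurable_prodMk_left (x := θ)))).1 hθ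
  refine ⟨fun p => g (p.1 * Real.cos θ, p.1 * Real.sin θ, p.2), by fun_prop, ?_⟩
  filter_upwards [hθ, ae_restrict_mem measurableSet_Omega] with p hp hpO
  have hp1 : 0 < p.1 := hpO.1
  have hnot : (p.1 * Real.cos θ, p.1 * Real.sin θ, p.2) ∉ N := by
    intro hmem
    simp [Set.indicator_of_mem hmem] at hp
    linarith
  by_contra hcon
  refine hnot (hsub ?_)
  intro hh
  apply hcon
  simpa [meridional_cylindrical hpO] using hh

theorem lintegral_inv_sq_add_mul_sq {ρ b : ℝ} (hρ : 0 < ρ) (hb : 0 < b) :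
    ∫⁻ t : ℝ, ENNReal.ofReal (ρ ^ 2 + b ^ 2 * t ^ 2)⁻¹ = ENNReal.ofReal (Real.pi / (ρ * b)) := by
  have hc : b / ρ ≠ 0 := (div_pos hb hρ).ne'
  have hfun : (fun t : ℝ => (ρ ^ 2 + b ^ 2 * t ^ 2)⁻¹) =
      fun t => (ρ ^ 2)⁻¹ * (1 + (b / ρ * t) ^ 2)⁻¹ := by
    funext t
    rw [← mul_inv]
    congr 1
    field_simp
  have hint : Integrable fun t : ℝ => (ρ ^ 2 + b ^ 2 * t ^ 2)⁻¹ := by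
    rw [hfun]
    exact (integrable_inv_one_add_sq.comp_mul_left' hc).const_mul _
  rw [← ofReal_integral_eq_lintegral_ofReal hint (.of_forall fun t => by positivity), hfun,
    integral_const_mul, Measure.integral_comp_mul_left (fun t : ℝ => (1 + t ^ 2)⁻¹),
    integral_univ_inv_one_add_sq, abs_of_pos (inv_pos.2 (div_pos hb hρ)), smul_eq_mul]
  congr 1
  field_simp

/-- On `[-2π, 2π]`, the function `1 - cos` is bounded below by a quadratic centred at one of the
zeros `0`, `2π`, `-2π`. -/
theorem exists_quadratic_le_one_sub_cos {t : ℝ} (ht : |t| ≤ 2 * Real.pi) :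
    ∃ u ∈ ({t, t - 2 * Real.pi, t + 2 * Real.pi} : Set ℝ),
      2 / Real.pi ^ 2 * u ^ 2 ≤ 1 - Real.cos t := by
  have hpi := Real.pi_pos
  obtain ⟨h1, h2⟩ := abs_le.1 ht
  by_cases h : |t| ≤ Real.pi
  · exact ⟨t, by simp, by linarith [Real.cos_le_one_sub_mul_cos_sq h]⟩
  rcases lt_abs.1 (not_le.1 h) with h | h
  · refine ⟨t - 2 * Real.pi, by simp, ?_⟩
    have := Real.cos_le_one_sub_mul_cos_sq (x := t - 2 * Real.pi)
      (abs_le.2 ⟨by linarith, by linarith⟩)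
    rw [Real.cos_sub_two_pi] at this
    linarith
  · refine ⟨t + 2 * Real.pi, by simp, ?_⟩
    have := Real.cos_le_one_sub_mul_cos_sq (x := t + 2 * Real.pi)
      (abs_le.2 ⟨by linarith, by linarith⟩)
    rw [Real.cos_add_two_pi] at this
    linarith

theorem lintegral_angular_le_of_pos {ρ k φ : ℝ} (hρ : 0 < ρ) (hk : 0 < k)
    (hφ : |φ| ≤ Real.pi) :
    ∫⁻ θ in Set.Ioo (-Real.pi) Real.pi,
        ENNReal.ofReal (ρ ^ 2 + k ^ 2 * (1 - Real.cos (θ - φ)))⁻¹ ≤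
      3 * ENNReal.ofReal (Real.pi ^ 2 / (ρ * k)) := by
  have hpi := Real.pi_pos
  set b : ℝ := k / Real.pi with hbdef
  have hb : 0 < b := by positivity
  set g : ℝ → ℝ≥0∞ := fun t => ENNReal.ofReal (ρ ^ 2 + b ^ 2 * t ^ 2)⁻¹ with hg
  have hgm : Measurable g := by fun_prop
  have hle : ∀ θ ∈ Set.Ioo (-Real.pi) Real.pi,
      ENNReal.ofReal (ρ ^ 2 + k ^ 2 * (1 - Real.cos (θ - φ)))⁻¹ ≤
        g (θ - φ) + g (θ - (φ + 2 * Real.pi)) + g (θ - (φ - 2 * Real.pi)) := by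
    intro θ hθ
    obtain ⟨h1, h2⟩ := abs_le.1 hφ
    obtain ⟨u, hu, hcos⟩ := exists_quadratic_le_one_sub_cos (t := θ - φ)
      (abs_le.2 ⟨by linarith [hθ.1], by linarith [hθ.2]⟩)
    have hmain : ENNReal.ofReal (ρ ^ 2 + k ^ 2 * (1 - Real.cos (θ - φ)))⁻¹ ≤ g u := by
      refine ENNReal.ofReal_le_ofReal (inv_anti₀ (by positivity) ?_)
      have : b ^ 2 * u ^ 2 ≤ k ^ 2 * (2 / Real.pi ^ 2 * u ^ 2) := by
        have : k ^ 2 * (2 / Real.pi ^ 2 * u ^ 2) = 2 * (b ^ 2 * u ^ 2) := by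
          rw [hbdef]; ring
        rw [this]
        nlinarith [mul_nonneg (sq_nonneg b) (sq_nonneg u)]
      nlinarith [mul_le_mul_of_nonneg_left hcos (sq_nonneg k)]
    rcases hu with rfl | rfl | rfl
    · exact hmain.trans (le_add_right le_self_add)
    · refine hmain.trans (le_add_right (le_trans (le_of_eq ?_) le_add_self))
      congr 1; ring
    · refine hmain.trans (le_trans (le_of_eq ?_) le_add_self)
      congr 1; ring
  have hshift : ∀ c : ℝ, ∫⁻ θ, g (θ - c) = ENNReal.ofReal (Real.pi ^ 2 / (ρ * k)) := by
    intro c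
    rw [lintegral_sub_right_eq_self g c, hg, lintegral_inv_sq_add_mul_sq hρ hb]
    congr 1
    rw [hbdef]
    field_simp
  calc _ ≤ ∫⁻ θ in Set.Ioo (-Real.pi) Real.pi,
        (g (θ - φ) + g (θ - (φ + 2 * Real.pi)) + g (θ - (φ - 2 * Real.pi))) :=
        setLIntegral_mono' measurableSet_Ioo hle
    _ ≤ ∫⁻ θ, (g (θ - φ) + g (θ - (φ + 2 * Real.pi)) + g (θ - (φ - 2 * Real.pi))) :=
        setLIntegral_le_lintegral _ _
    _ = _ := by
        rw [lintegral_add_left (by fun_prop), lintegral_add_left (by fun_prop),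
          hshift, hshift, hshift]
        ring

/-- The angular integral of the Biot–Savart kernel has at most the singularity of the planar
kernel. -/
theorem lintegral_angular_kernel_le {r s ρ φ : ℝ} (hr : 0 ≤ r) (hs : 0 < s) (hρ : 0 < ρ)
    (hrs : |s - r| ≤ ρ) (hφ : |φ| ≤ Real.pi) :
    ∫⁻ θ in Set.Ioo (-Real.pi) Real.pi, ENNReal.ofReal s *
        ENNReal.ofReal (ρ ^ 2 + 2 * r * s * (1 - Real.cos (θ - φ)))⁻¹ ≤
      ENNReal.ofReal (3 * Real.pi ^ 2 * ρ⁻¹) := by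
  have hpi := Real.pi_gt_three
  rcases le_or_gt s (2 * r) with h | h
  · have hr' : 0 < r := by linarith
    set k := Real.sqrt (2 * r * s) with hkdef
    have hk : 0 < k := Real.sqrt_pos.2 (by positivity)
    have hk2 : k ^ 2 = 2 * r * s := Real.sq_sqrt (by positivity)
    have hsk : s ≤ k := Real.le_sqrt_of_sq_le (by nlinarith)
    rw [← hk2, lintegral_const_mul _ (by fun_prop)]
    refine (mul_le_mul_right (lintegral_angular_le_of_pos hρ hk hφ) _).trans ?_
    rw [show (3 : ℝ≥0∞) = ENNReal.ofReal 3 by simp, ← ENNReal.ofReal_mul (by norm_num),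
      ← ENNReal.ofReal_mul hs.le]
    refine ENNReal.ofReal_le_ofReal ?_
    calc s * (3 * (Real.pi ^ 2 / (ρ * k))) = (s / k) * (3 * Real.pi ^ 2 * ρ⁻¹) := by
          field_simp
      _ ≤ 1 * (3 * Real.pi ^ 2 * ρ⁻¹) := by
          gcongr
          exact (div_le_one hk).2 hsk
      _ = _ := one_mul _
  · have hsρ : s ≤ 2 * ρ := by linarith [le_abs_self (s - r)]
    calc _ ≤ ∫⁻ θ in Set.Ioo (-Real.pi) Real.pi, ENNReal.ofReal (2 * ρ⁻¹) := by
          refine lintegral_mono fun θ => ?_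
          rw [← ENNReal.ofReal_mul hs.le]
          refine ENNReal.ofReal_le_ofReal ?_
          have hcos : 0 ≤ 2 * r * s * (1 - Real.cos (θ - φ)) :=
            mul_nonneg (by positivity) (by linarith [Real.cos_le_one (θ - φ)])
          calc s * (ρ ^ 2 + 2 * r * s * (1 - Real.cos (θ - φ)))⁻¹ ≤ 2 * ρ * (ρ ^ 2)⁻¹ := by
                refine mul_le_mul hsρ (inv_anti₀ (by positivity) (by linarith)) (by positivity)
                  (by positivity)
            _ = 2 * ρ⁻¹ := by field_simp
      _ = ENNReal.ofReal (2 * ρ⁻¹ * (Real.pi - -Real.pi)) := by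
          rw [lintegral_const, Measure.restrict_apply_univ, Real.volume_Ioo,
            ← ENNReal.ofReal_mul (by positivity)]
      _ ≤ _ := by
          refine ENNReal.ofReal_le_ofReal ?_
          have : 0 < ρ⁻¹ := inv_pos.2 hρ
          nlinarith [mul_pos this Real.pi_pos]

theorem exists_polar (a b : ℝ) : ∃ φ : ℝ, |φ| ≤ Real.pi ∧
    a = Real.sqrt (a ^ 2 + b ^ 2) * Real.cos φ ∧ b = Real.sqrt (a ^ 2 + b ^ 2) * Real.sin φ := by
  refine ⟨Complex.arg ⟨a, b⟩, Complex.abs_arg_le_pi _, ?_, ?_⟩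
  · have := Complex.norm_mul_cos_arg ⟨a, b⟩
    rw [Complex.norm_eq_sqrt_sq_add_sq] at this
    exact this.symm
  · have := Complex.norm_mul_sin_arg ⟨a, b⟩
    rw [Complex.norm_eq_sqrt_sq_add_sq] at this
    exact this.symm

theorem enorm3_sq (v : ℝ × ℝ × ℝ) : enorm3 v ^ 2 = v.1 ^ 2 + v.2.1 ^ 2 + v.2.2 ^ 2 :=
  Real.sq_sqrt (by positivity)

theorem lintegral_kernel_cylindrical_le (x : ℝ × ℝ × ℝ) {p : ℝ × ℝ} (hp : p ∈ Omega)
    (hpx : p ≠ meridional x) :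
    ∫⁻ θ in Set.Ioo (-Real.pi) Real.pi, ENNReal.ofReal p.1 * ENNReal.ofReal
        (enorm3 (x - (p.1 * Real.cos θ, p.1 * Real.sin θ, p.2)) ^ 2)⁻¹ ≤
      ENNReal.ofReal (3 * Real.pi ^ 2 * ‖p - meridional x‖⁻¹) := by
  obtain ⟨φ, hφ, h1, h2⟩ := exists_polar x.1 x.2.1
  set r := Real.sqrt (x.1 ^ 2 + x.2.1 ^ 2) with hr
  have hmer : meridional x = (r, x.2.2) := rfl
  set ρ := Real.sqrt ((p.1 - r) ^ 2 + (p.2 - x.2.2) ^ 2) with hρdef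
  have hnorm : ‖p - meridional x‖ ≤ ρ := by
    rw [hmer, Prod.norm_def, max_le_iff]
    exact ⟨Real.abs_le_sqrt (by simp; positivity), Real.abs_le_sqrt (by simp; positivity)⟩
  have hpos : 0 < ‖p - meridional x‖ := norm_pos_iff.2 (sub_ne_zero.2 hpx)
  have hρ2 : ρ ^ 2 = (p.1 - r) ^ 2 + (p.2 - x.2.2) ^ 2 := Real.sq_sqrt (by positivity)
  have hker : ∀ θ, enorm3 (x - (p.1 * Real.cos θ, p.1 * Real.sin θ, p.2)) ^ 2 =
      ρ ^ 2 + 2 * r * p.1 * (1 - Real.cos (θ - φ)) := by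
    intro θ
    rw [enorm3_sq, hρ2, Real.cos_sub]
    simp only [Prod.fst_sub, Prod.snd_sub]
    rw [show x.1 - p.1 * Real.cos θ = r * Real.cos φ - p.1 * Real.cos θ by rw [← h1],
      show x.2.1 - p.1 * Real.sin θ = r * Real.sin φ - p.1 * Real.sin θ by rw [← h2]]
    linear_combination r ^ 2 * Real.sin_sq_add_cos_sq φ + p.1 ^ 2 * Real.sin_sq_add_cos_sq θ
  simp_rw [hker]
  refine (lintegral_angular_kernel_le (Real.sqrt_nonneg _) hp.1 (hpos.trans_le hnorm)
    (Real.abs_le_sqrt (by nlinarith [sq_nonneg (p.2 - x.2.2)])) hφ).trans ?_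
  refine ENNReal.ofReal_le_ofReal ?_
  gcongr

theorem lintegral_fun_norm_plane {f : ℝ → ℝ} (hf0 : ∀ y, 0 ≤ f y)
    (hf : IntegrableOn (fun y => y * f y) (Set.Ioi 0)) :
    ∫⁻ p : ℝ × ℝ, ENNReal.ofReal (f ‖p‖) =
      ENNReal.ofReal (2 * (volume.real (Metric.ball (0 : ℝ × ℝ) 1) *
        ∫ y in Set.Ioi 0, y * f y)) := by
  have hint : Integrable (fun p : ℝ × ℝ => f ‖p‖) := by
    rw [integrable_fun_norm_addHaar volume]
    simpa using hf
  rw [← ofReal_integral_eq_lintegral_ofReal hint (.of_forall fun p => hf0 _),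
    integral_fun_norm_addHaar]
  simp

theorem exists_lintegral_norm_rpow_near {q : ℝ} (hq : q < 2) :
    ∃ C : ℝ, 0 ≤ C ∧ ∀ R : ℝ, 0 < R →
      ∫⁻ p : ℝ × ℝ, ENNReal.ofReal ((Set.Iio R).indicator (fun y => y ^ (-q)) ‖p‖) ≤
        ENNReal.ofReal (C * R ^ (2 - q)) := by
  refine ⟨2 * (volume.real (Metric.ball (0 : ℝ × ℝ) 1) * (2 - q)⁻¹),
    by have := inv_pos.2 (sub_pos.2 hq); positivity, fun R hR => ?_⟩
  set f : ℝ → ℝ := (Set.Iio R).indicator (fun y => |y| ^ (-q)) with hf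
  have hf0 : ∀ y, 0 ≤ f y := fun y => Set.indicator_nonneg (fun y _ => by positivity) y
  have hfun : ∀ y ∈ Set.Ioi (0 : ℝ), y * f y =
      (Set.Iio R).indicator (fun y => y ^ (1 - q)) y := by
    intro y hy
    by_cases h : y ∈ Set.Iio R
    · rw [hf, Set.indicator_of_mem h, Set.indicator_of_mem h, abs_of_pos hy, sub_eq_add_neg,
        Real.rpow_add hy, Real.rpow_one]
    · rw [hf, Set.indicator_of_notMem h, Set.indicator_of_notMem h, mul_zero]
  have hset : Set.Iio R ∩ Set.Ioi 0 = Set.Ioo 0 R := by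
    rw [Set.inter_comm, Set.Ioi_inter_Iio]
  have hint : IntegrableOn (fun y => y * f y) (Set.Ioi 0) := by
    rw [integrableOn_congr_fun hfun measurableSet_Ioi, IntegrableOn,
      integrable_indicator_iff measurableSet_Iio, IntegrableOn,
      Measure.restrict_restrict measurableSet_Iio, hset, ← IntegrableOn,
      intervalIntegral.integrableOn_Ioo_rpow_iff hR]
    linarith
  have hval : ∫ y in Set.Ioi 0, y * f y = R ^ (2 - q) * (2 - q)⁻¹ := by
    rw [setIntegral_congr_fun measurableSet_Ioi hfun, integral_indicator measurableSet_Iio,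
      Measure.restrict_restrict measurableSet_Iio, hset, ← integral_Ioc_eq_integral_Ioo,
      ← intervalIntegral.integral_of_le hR.le, integral_rpow (Or.inl (by linarith)),
      show 1 - q + 1 = 2 - q by ring, Real.zero_rpow (by linarith), sub_zero, div_eq_mul_inv]
  have heq : ∀ p : ℝ × ℝ, (Set.Iio R).indicator (fun y => y ^ (-q)) ‖p‖ = f ‖p‖ := by
    intro p
    simp only [hf, Set.indicator_apply, abs_norm]
  simp_rw [heq]
  rw [lintegral_fun_norm_plane hf0 hint, hval]
  exact le_of_eq (by ring_nf)

theorem exists_lintegral_norm_rpow_far {q : ℝ} (hq : 2 < q) :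
    ∃ C : ℝ, 0 ≤ C ∧ ∀ R : ℝ, 0 < R →
      ∫⁻ p : ℝ × ℝ, ENNReal.ofReal ((Set.Ioi R).indicator (fun y => y ^ (-q)) ‖p‖) ≤
        ENNReal.ofReal (C * R ^ (2 - q)) := by
  refine ⟨2 * (volume.real (Metric.ball (0 : ℝ × ℝ) 1) * (q - 2)⁻¹),
    by have := inv_pos.2 (sub_pos.2 hq); positivity, fun R hR => ?_⟩
  set f : ℝ → ℝ := (Set.Ioi R).indicator (fun y => y ^ (-q)) with hf
  have hf0 : ∀ y, 0 ≤ f y := fun y => Set.indicator_nonneg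
    (fun y hy => Real.rpow_nonneg (hR.trans hy).le _) y
  have hfun : (fun y => y * f y) = (Set.Ioi R).indicator (fun y => y ^ (1 - q)) := by
    funext y
    by_cases h : y ∈ Set.Ioi R
    · rw [hf, Set.indicator_of_mem h, Set.indicator_of_mem h, sub_eq_add_neg,
        Real.rpow_add (hR.trans h), Real.rpow_one]
    · rw [hf, Set.indicator_of_notMem h, Set.indicator_of_notMem h, mul_zero]
  have hset : Set.Ioi R ∩ Set.Ioi 0 = Set.Ioi R := by
    rw [Set.Ioi_inter_Ioi, max_eq_left hR.le]
  have hint : IntegrableOn (fun y => y * f y) (Set.Ioi 0) := by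
    rw [hfun]
    exact ((integrable_indicator_iff measurableSet_Ioi).2
      (integrableOn_Ioi_rpow_of_lt (by linarith) hR)).integrableOn
  have hval : ∫ y in Set.Ioi 0, y * f y = R ^ (2 - q) * (q - 2)⁻¹ := by
    rw [hfun, integral_indicator measurableSet_Ioi,
      Measure.restrict_restrict measurableSet_Ioi, hset,
      integral_Ioi_rpow_of_lt (by linarith) hR, show 1 - q + 1 = -(q - 2) by ring, neg_div_neg_eq,
      neg_sub, div_eq_mul_inv]
  rw [lintegral_fun_norm_plane hf0 hint, hval]
  exact le_of_eq (by ring_nf)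

theorem lintegral_mul_indicator_norm_inv_le {p q : ℝ} (hpq : p.HolderConjugate q)
    {f : ℝ × ℝ → ℝ} (hf : AEMeasurable f (volume.restrict Omega)) {s : Set ℝ}
    (hs : MeasurableSet s) (a : ℝ × ℝ) {C R : ℝ} (hC : 0 ≤ C) (hR : 0 < R)
    (hsC : ∫⁻ w : ℝ × ℝ, ENNReal.ofReal (s.indicator (fun y => y ^ (-q)) ‖w‖) ≤
      ENNReal.ofReal (C * R ^ (2 - q))) :
    ∫⁻ w in Omega, ‖f w‖ₑ * ENNReal.ofReal (s.indicator (fun y => y⁻¹) ‖w - a‖) ≤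
      ENNReal.ofReal (C ^ (1 / q) * R ^ (1 - 2 / p)) *
        eLpNorm f (ENNReal.ofReal p) (volume.restrict Omega) := by
  have hp := hpq.pos
  have hq := hpq.symm.pos
  have hm : Measurable fun w : ℝ × ℝ => ENNReal.ofReal (s.indicator (fun y => y⁻¹) ‖w - a‖) :=
    ENNReal.measurable_ofReal.comp ((measurable_inv.indicator hs).comp (by fun_prop))
  refine (ENNReal.lintegral_mul_le_Lp_mul_Lq _ hpq hf.enorm hm.aemeasurable).trans ?_
  rw [mul_comm, eLpNorm_eq_lintegral_rpow_enorm_toReal (by simpa using hp) ENNReal.ofReal_ne_top,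
    ENNReal.toReal_ofReal hp.le]
  gcongr
  have hpow : ∀ w : ℝ × ℝ, ENNReal.ofReal (s.indicator (fun y => y⁻¹) ‖w - a‖) ^ q =
      ENNReal.ofReal (s.indicator (fun y => y ^ (-q)) ‖w - a‖) := by
    intro w
    by_cases h : ‖w - a‖ ∈ s
    · rw [Set.indicator_of_mem h, Set.indicator_of_mem h,
        ENNReal.ofReal_rpow_of_nonneg (by positivity) hq.le, Real.inv_rpow (norm_nonneg _),
        Real.rpow_neg (norm_nonneg _)]
    · rw [Set.indicator_of_notMem h, Set.indicator_of_notMem h, ENNReal.ofReal_zero,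
        ENNReal.zero_rpow_of_pos hq]
  simp_rw [hpow]
  calc (∫⁻ w in Omega, ENNReal.ofReal (s.indicator (fun y => y ^ (-q)) ‖w - a‖)) ^ (1 / q)
      ≤ (∫⁻ w, ENNReal.ofReal (s.indicator (fun y => y ^ (-q)) ‖w - a‖)) ^ (1 / q) := by
        gcongr
        exact Measure.restrict_le_self
    _ = (∫⁻ w : ℝ × ℝ, ENNReal.ofReal (s.indicator (fun y => y ^ (-q)) ‖w‖)) ^ (1 / q) := by
        rw [lintegral_sub_right_eq_self
          (fun w : ℝ × ℝ => ENNReal.ofReal (s.indicator (fun y => y ^ (-q)) ‖w‖)) a]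
    _ ≤ ENNReal.ofReal (C * R ^ (2 - q)) ^ (1 / q) := by gcongr
    _ = ENNReal.ofReal (C ^ (1 / q) * R ^ (1 - 2 / p)) := by
        rw [ENNReal.ofReal_rpow_of_nonneg (by positivity) (by positivity),
          Real.mul_rpow hC (by positivity), ← Real.rpow_mul hR.le]
        congr 3
        have := hpq.inv_add_inv_eq_one
        have hq' : q⁻¹ = 1 - p⁻¹ := by linarith
        have : (2 - q) * (1 / q) = 2 * q⁻¹ - 1 := by field_simp
        rw [this, hq']
        ring

theorem exists_lintegral_div_norm_le {m ℓ : ℝ} (hm : 1 < m) (hm2 : m < 2) (hℓ : 2 < ℓ) :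
    ∃ C : ℝ, 0 < C ∧ ∀ f : ℝ × ℝ → ℝ, AEMeasurable f (volume.restrict Omega) →
      ∀ a : ℝ × ℝ, ∀ R : ℝ, 0 < R →
        ∫⁻ w in Omega, ‖f w‖ₑ * ENNReal.ofReal ‖w - a‖⁻¹ ≤ ENNReal.ofReal C *
          (ENNReal.ofReal (R ^ (1 - 2 / m)) *
              eLpNorm f (ENNReal.ofReal m) (volume.restrict Omega) +
            ENNReal.ofReal (R ^ (1 - 2 / ℓ)) *
              eLpNorm f (ENNReal.ofReal ℓ) (volume.restrict Omega)) := by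
  have hcm := Real.HolderConjugate.conjExponent hm
  have hcℓ := Real.HolderConjugate.conjExponent (by linarith : 1 < ℓ)
  have h1 : 2 < Real.conjExponent m := by
    rw [Real.conjExponent, lt_div_iff₀ (by linarith)]; linarith
  have h2 : Real.conjExponent ℓ < 2 := by
    rw [Real.conjExponent, div_lt_iff₀ (by linarith)]; linarith
  obtain ⟨C₁, hC₁, hfar⟩ := exists_lintegral_norm_rpow_far h1
  obtain ⟨C₂, hC₂, hnear⟩ := exists_lintegral_norm_rpow_near h2
  set D₁ := C₁ ^ (1 / Real.conjExponent m) with hD₁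
  set D₂ := C₂ ^ (1 / Real.conjExponent ℓ) with hD₂
  have hD₁0 : 0 ≤ D₁ := by positivity
  have hD₂0 : 0 ≤ D₂ := by positivity
  refine ⟨D₁ + D₂ + 1, by positivity, fun f hf a R hR => ?_⟩
  have hsplit : ∀ᵐ w ∂(volume.restrict Omega), ‖f w‖ₑ * ENNReal.ofReal ‖w - a‖⁻¹ =
      ‖f w‖ₑ * ENNReal.ofReal ((Set.Ioi R).indicator (fun y => y⁻¹) ‖w - a‖) +
        ‖f w‖ₑ * ENNReal.ofReal ((Set.Iio R).indicator (fun y => y⁻¹) ‖w - a‖) := by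
    have hsphere : ∀ᵐ w : ℝ × ℝ, w ∉ Metric.sphere a R :=
      measure_eq_zero_iff_ae_notMem.1 (Measure.addHaar_sphere _ a R)
    filter_upwards [ae_restrict_of_ae hsphere] with w hw
    rw [mem_sphere_iff_norm] at hw
    rcases lt_or_gt_of_ne hw with h | h
    · rw [Set.indicator_of_notMem (by simpa using h.le), Set.indicator_of_mem (by simpa using h)]
      simp
    · rw [Set.indicator_of_mem (by simpa using h), Set.indicator_of_notMem (by simpa using h.le)]
      simp
  have hm : AEMeasurable (fun w => ‖f w‖ₑ * ENNReal.ofReal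
      ((Set.Ioi R).indicator (fun y => y⁻¹) ‖w - a‖)) (volume.restrict Omega) :=
    hf.enorm.mul (ENNReal.measurable_ofReal.comp
      ((measurable_inv.indicator measurableSet_Ioi).comp (by fun_prop))).aemeasurable
  rw [lintegral_congr_ae hsplit, lintegral_add_left' hm, mul_add]
  refine add_le_add
    ((lintegral_mul_indicator_norm_inv_le hcm hf measurableSet_Ioi a hC₁ hR (hfar R hR)).trans ?_)
    ((lintegral_mul_indicator_norm_inv_le hcℓ hf measurableSet_Iio a hC₂ hR (hnear R hR)).trans ?_)
  · rw [← mul_assoc, ← ENNReal.ofReal_mul (by positivity)]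
    gcongr
    linarith
  · rw [← mul_assoc, ← ENNReal.ofReal_mul (by positivity)]
    gcongr
    linarith

theorem rpow_interpolation_identity {a b m ℓ : ℝ} (ha : 0 < a) (hb : 0 < b) (hm : 1 < m)
    (hm2 : m < 2) (hℓ : 2 < ℓ) :
    ((a / b) ^ (m * ℓ / (2 * (ℓ - m)))) ^ (1 - 2 / m) * a =
        a ^ ((m / 2) * (ℓ - 2) / (ℓ - m)) * b ^ (1 - (m / 2) * (ℓ - 2) / (ℓ - m)) ∧
      ((a / b) ^ (m * ℓ / (2 * (ℓ - m)))) ^ (1 - 2 / ℓ) * b =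
        a ^ ((m / 2) * (ℓ - 2) / (ℓ - m)) * b ^ (1 - (m / 2) * (ℓ - 2) / (ℓ - m)) := by
  have h0 : ℓ - m ≠ 0 := by linarith
  have hm0 : m ≠ 0 := by linarith
  have hℓ0 : ℓ ≠ 0 := by linarith
  set α := (m / 2) * (ℓ - 2) / (ℓ - m) with hα
  have e1 : m * ℓ / (2 * (ℓ - m)) * (1 - 2 / m) = α - 1 := by
    rw [hα]; field_simp; ring
  have e2 : m * ℓ / (2 * (ℓ - m)) * (1 - 2 / ℓ) = α := by
    rw [hα]; field_simp
  have hab : 0 < a / b := div_pos ha hb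
  rw [← Real.rpow_mul hab.le, ← Real.rpow_mul hab.le, e1, e2, Real.div_rpow ha.le hb.le,
    Real.div_rpow ha.le hb.le, Real.rpow_sub_one ha.ne', Real.rpow_sub_one hb.ne',
    Real.rpow_sub hb, Real.rpow_one]
  have := (Real.rpow_pos_of_pos hb α).ne'
  constructor <;> field_simp

theorem le_interpolation_of_forall_radius {m ℓ C : ℝ} (hm : 1 < m) (hm2 : m < 2) (hℓ : 2 < ℓ)
    {I A B : ℝ≥0∞} (hA0 : A ≠ 0) (hA : A ≠ ⊤) (hB0 : B ≠ 0) (hB : B ≠ ⊤)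
    (h : ∀ R : ℝ, 0 < R → I ≤ ENNReal.ofReal C *
      (ENNReal.ofReal (R ^ (1 - 2 / m)) * A + ENNReal.ofReal (R ^ (1 - 2 / ℓ)) * B)) :
    I ≤ ENNReal.ofReal C * (2 * (A ^ ((m / 2) * (ℓ - 2) / (ℓ - m)) *
      B ^ (1 - (m / 2) * (ℓ - 2) / (ℓ - m)))) := by
  have ha := ENNReal.toReal_pos hA0 hA
  have hb := ENNReal.toReal_pos hB0 hB
  obtain ⟨e1, e2⟩ := rpow_interpolation_identity ha hb hm hm2 hℓ
  have hR := h _ (Real.rpow_pos_of_pos (div_pos ha hb) (m * ℓ / (2 * (ℓ - m))))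
  rw [← ENNReal.ofReal_toReal hA, ← ENNReal.ofReal_toReal hB, ENNReal.toReal_ofReal ha.le,
    ENNReal.toReal_ofReal hb.le, ← ENNReal.ofReal_mul (by positivity),
    ← ENNReal.ofReal_mul (by positivity), e1, e2, ← two_mul, ENNReal.ofReal_mul (by positivity)]
    at hR
  rwa [← ENNReal.ofReal_toReal hA, ← ENNReal.ofReal_toReal hB,
    ENNReal.ofReal_rpow_of_pos ha, ENNReal.ofReal_rpow_of_pos hb]

theorem enorm3_le_two_mul_norm (v : ℝ × ℝ × ℝ) : enorm3 v ≤ 2 * ‖v‖ := by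
  have h1 : v.1 ^ 2 ≤ ‖v‖ ^ 2 := sq_le_sq.2 (by simpa using norm_fst_le v)
  have h2 : v.2.1 ^ 2 ≤ ‖v‖ ^ 2 :=
    sq_le_sq.2 (by simpa using (norm_fst_le v.2).trans (norm_snd_le v))
  have h3 : v.2.2 ^ 2 ≤ ‖v‖ ^ 2 :=
    sq_le_sq.2 (by simpa using (norm_snd_le v.2).trans (norm_snd_le v))
  exact Real.sqrt_le_iff.2 ⟨by positivity, by nlinarith [sq_nonneg ‖v‖]⟩

theorem norm_cross3_vortVec_le (a : ℝ × ℝ × ℝ) (ω : ℝ × ℝ → ℝ) (y : ℝ × ℝ × ℝ) :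
    ‖cross3 a (vortVec ω y)‖ ≤ 2 * enorm3 a * |ω (meridional y)| := by
  have e1 : |a.1| ≤ enorm3 a := Real.abs_le_sqrt (by nlinarith [sq_nonneg a.2.1, sq_nonneg a.2.2])
  have e2 : |a.2.1| ≤ enorm3 a := Real.abs_le_sqrt (by nlinarith [sq_nonneg a.1, sq_nonneg a.2.2])
  have e3 : |a.2.2| ≤ enorm3 a := Real.abs_le_sqrt (by nlinarith [sq_nonneg a.1, sq_nonneg a.2.1])
  have he : 0 ≤ enorm3 a := Real.sqrt_nonneg _
  set s := Real.sqrt (y.1 ^ 2 + y.2.1 ^ 2) with hs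
  set W := ω (meridional y) with hW
  have hc : ∀ t : ℝ, |t| ≤ s → |t / s * W| ≤ |W| := by
    intro t ht
    rw [abs_mul, abs_div, abs_of_nonneg (show 0 ≤ s from Real.sqrt_nonneg _)]
    exact mul_le_of_le_one_left (abs_nonneg _) (div_le_one_of_le₀ ht (Real.sqrt_nonneg _))
  have c1 := hc y.1 (Real.abs_le_sqrt (by nlinarith [sq_nonneg y.2.1]))
  have c2 := hc y.2.1 (Real.abs_le_sqrt (by nlinarith [sq_nonneg y.1]))
  have hv : vortVec ω y = (-(y.2.1 / s * W), y.1 / s * W, 0) := by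
    simp only [vortVec, hW, meridional, hs, neg_mul]
  have hmul : ∀ u v : ℝ, |u| ≤ enorm3 a → |v| ≤ |W| → |u * v| ≤ enorm3 a * |W| := by
    intro u v hu hv
    rw [abs_mul]
    gcongr
  have hnn : 0 ≤ enorm3 a * |W| := by positivity
  rw [hv, cross3]
  simp only [Prod.norm_def, Real.norm_eq_abs, max_le_iff, mul_zero, zero_sub, sub_zero, abs_neg]
  refine ⟨(hmul _ _ e3 c1).trans (by linarith), ?_, ?_⟩
  · exact (hmul _ _ e3 (by rwa [abs_neg])).trans (by linarith)
  · refine (abs_sub _ _).trans ?_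
    linarith [hmul _ _ e1 c1, hmul _ (-(y.2.1 / s * W)) e2 (by rwa [abs_neg])]

theorem enorm_biotSavart_integrand_le (ω : ℝ × ℝ → ℝ) (x y : ℝ × ℝ × ℝ) :
    ‖((enorm3 (x - y))⁻¹ ^ 3) • cross3 (x - y) (vortVec ω y)‖ₑ ≤
      2 * (ENNReal.ofReal (enorm3 (x - y) ^ 2)⁻¹ * ‖ω (meridional y)‖ₑ) := by
  have he : 0 ≤ enorm3 (x - y) := Real.sqrt_nonneg _
  rw [← ofReal_norm, ← ofReal_norm, ← ENNReal.ofReal_mul (by positivity),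
    show (2 : ℝ≥0∞) = ENNReal.ofReal 2 by simp, ← ENNReal.ofReal_mul (by norm_num)]
  refine ENNReal.ofReal_le_ofReal ?_
  rw [norm_smul, Real.norm_of_nonneg (by positivity), Real.norm_eq_abs]
  refine (mul_le_mul_of_nonneg_left (norm_cross3_vortVec_le _ _ _) (by positivity)).trans ?_
  rcases he.eq_or_lt with h | h
  · simp [← h]
  · exact le_of_eq (by field_simp)

theorem measurable_enorm3 : Measurable enorm3 := by
  unfold enorm3; fun_prop

theorem lintegral_kernel_le {g : ℝ × ℝ → ℝ} (hg : Measurable g) (x : ℝ × ℝ × ℝ) :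
    ∫⁻ y, ENNReal.ofReal (enorm3 (x - y) ^ 2)⁻¹ * ‖g (meridional y)‖ₑ ≤
      ENNReal.ofReal (3 * Real.pi ^ 2) *
        ∫⁻ w in Omega, ‖g w‖ₑ * ENNReal.ofReal ‖w - meridional x‖⁻¹ := by
  have he := measurable_enorm3
  have hmer := measurable_meridional
  rw [lintegral_cylindrical (by fun_prop), lintegral_lintegral_swap (Measurable.aemeasurable
    (by fun_prop)), ← lintegral_const_mul _ (by fun_prop)]
  have hne : ∀ᵐ p : ℝ × ℝ, p ≠ meridional x := by
    rw [ae_iff]; simp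
  refine lintegral_mono_ae ?_
  filter_upwards [ae_restrict_of_ae hne, ae_restrict_mem measurableSet_Omega] with p hpx hp
  simp_rw [meridional_cylindrical hp, ← mul_assoc]
  rw [lintegral_mul_const _ (by fun_prop)]
  refine (mul_le_mul_left (lintegral_kernel_cylindrical_le x hp hpx) _).trans (le_of_eq ?_)
  rw [ENNReal.ofReal_mul (by positivity)]
  ring

/-- The axisymmetric velocity is controlled by the planar Riesz potential of the vorticity. -/
theorem ofReal_enorm3_biotSavart_le {ω : ℝ × ℝ → ℝ}
    (hω : AEMeasurable ω (volume.restrict Omega)) (x : ℝ × ℝ × ℝ) :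
    ENNReal.ofReal (enorm3 (biotSavart ω x)) ≤ ENNReal.ofReal (6 * Real.pi ^ 2) *
      ∫⁻ w in Omega, ‖ω w‖ₑ * ENNReal.ofReal ‖w - meridional x‖⁻¹ := by
  have hpi := Real.pi_gt_three
  have hnorm : enorm3 (biotSavart ω x) ≤
      ‖∫ y, ((enorm3 (x - y))⁻¹ ^ 3) • cross3 (x - y) (vortVec ω y)‖ := by
    refine (enorm3_le_two_mul_norm _).trans ?_
    rw [biotSavart, norm_smul, Real.norm_of_nonneg (by positivity), ← mul_assoc]
    refine mul_le_of_le_one_left (norm_nonneg _) ?_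
    rw [← div_eq_mul_inv, div_le_one (by positivity)]
    linarith
  have hmk : ∀ᵐ y : ℝ × ℝ × ℝ, ω (meridional y) = hω.mk ω (meridional y) :=
    quasiMeasurePreserving_meridional.ae hω.ae_eq_mk
  calc ENNReal.ofReal (enorm3 (biotSavart ω x))
      ≤ ‖∫ y, ((enorm3 (x - y))⁻¹ ^ 3) • cross3 (x - y) (vortVec ω y)‖ₑ := by
        rw [← ofReal_norm]
        exact ENNReal.ofReal_le_ofReal hnorm
    _ ≤ ∫⁻ y, 2 * (ENNReal.ofReal (enorm3 (x - y) ^ 2)⁻¹ * ‖ω (meridional y)‖ₑ) :=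
        (enorm_integral_le_lintegral_enorm _).trans
          (lintegral_mono fun y => enorm_biotSavart_integrand_le ω x y)
    _ = 2 * ∫⁻ y, ENNReal.ofReal (enorm3 (x - y) ^ 2)⁻¹ * ‖hω.mk ω (meridional y)‖ₑ := by
        rw [lintegral_const_mul' _ _ (by simp)]
        congr 1
        refine lintegral_congr_ae ?_
        filter_upwards [hmk] with y hy
        rw [hy]
    _ ≤ 2 * (ENNReal.ofReal (3 * Real.pi ^ 2) *
        ∫⁻ w in Omega, ‖hω.mk ω w‖ₑ * ENNReal.ofReal ‖w - meridional x‖⁻¹) := by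
        gcongr
        exact lintegral_kernel_le hω.measurable_mk x
    _ = _ := by
        rw [← mul_assoc, show (2 : ℝ≥0∞) = ENNReal.ofReal 2 by simp,
          ← ENNReal.ofReal_mul (by norm_num), ← mul_assoc]
        norm_num only
        congr 1
        refine lintegral_congr_ae ?_
        filter_upwards [hω.ae_eq_mk] with w hw
        rw [hw]

/-- Measurability of the Biot–Savart integrand forces measurability of the vorticity. -/
theorem aemeasurable_of_biotSavart_integrand {ω : ℝ × ℝ → ℝ} {x : ℝ × ℝ × ℝ}
    (h : AEStronglyMeasurable
      (fun y => ((enorm3 (x - y))⁻¹ ^ 3) • cross3 (x - y) (vortVec ω y)) volume) :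
    AEMeasurable ω (volume.restrict Omega) := by
  have he := measurable_enorm3
  refine aemeasurable_of_comp_meridional ?_
  have hfst := h.aemeasurable.fst
  set c : ℝ × ℝ × ℝ → ℝ := fun y => (enorm3 (x - y))⁻¹ ^ 3 *
    -((x.2.2 - y.2.2) * (y.1 / Real.sqrt (y.1 ^ 2 + y.2.1 ^ 2))) with hc
  have hcm : Measurable c := by fun_prop
  refine (hfst.div hcm.aemeasurable).congr ?_
  have h1 : ∀ᵐ y : ℝ × ℝ × ℝ, y.1 ≠ 0 :=
    Measure.quasiMeasurePreserving_fst.ae (by rw [ae_iff]; simp : ∀ᵐ t : ℝ, t ≠ 0)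
  have h2 : ∀ᵐ y : ℝ × ℝ × ℝ, y.2.2 ≠ x.2.2 :=
    (Measure.quasiMeasurePreserving_snd.comp Measure.quasiMeasurePreserving_snd).ae
      (by rw [ae_iff]; simp : ∀ᵐ t : ℝ, t ≠ x.2.2)
  filter_upwards [h1, h2] with y hy1 hy2
  have hy2' : x.2.2 - y.2.2 ≠ 0 := sub_ne_zero.2 hy2.symm
  have hs : Real.sqrt (y.1 ^ 2 + y.2.1 ^ 2) ≠ 0 := (Real.sqrt_pos.2 (by positivity)).ne'
  have hen : enorm3 (x - y) ≠ 0 := by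
    intro h0
    have := enorm3_sq (x - y)
    rw [h0] at this
    have h3 : 0 < (x - y).2.2 ^ 2 := by
      simpa using sq_pos_of_ne_zero hy2'
    nlinarith [sq_nonneg (x - y).1, sq_nonneg (x - y).2.1]
  have hcne : c y ≠ 0 := by
    simp only [hc]
    exact mul_ne_zero (pow_ne_zero _ (inv_ne_zero hen))
      (neg_ne_zero.2 (mul_ne_zero hy2' (div_ne_zero hy1 hs)))
  rw [Pi.div_apply, div_eq_iff hcne]
  simp only [hc, cross3, vortVec, meridional, Prod.smul_fst, Prod.fst_sub, Prod.snd_sub,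
    smul_eq_mul]
  ring

/-- Biot–Savart interpolation estimate: for `1 < m < 2 < ℓ < ∞`, the velocity obtained
from `ω` via the axisymmetric Biot–Savart law satisfies
`‖v‖_{L^∞} ≤ C ‖ω‖_{L^m(Ω)}^α ‖ω‖_{L^ℓ(Ω)}^{1-α}` with `α = (m/2)(ℓ-2)/(ℓ-m) ∈ (0,1)`. -/
theorem biotSavart_Linfty_interpolation (m ℓ : ℝ) (hm : 1 < m) (hm2 : m < 2) (hℓ : 2 < ℓ) :
    (m / 2) * (ℓ - 2) / (ℓ - m) ∈ Set.Ioo (0 : ℝ) 1 ∧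
      ∃ C : ℝ, 0 < C ∧ ∀ ω : ℝ × ℝ → ℝ, ∀ x : ℝ × ℝ × ℝ,
        ENNReal.ofReal (enorm3 (biotSavart ω x)) ≤
          ENNReal.ofReal C *
            eLpNorm ω (ENNReal.ofReal m) (volume.restrict Omega) ^
              ((m / 2) * (ℓ - 2) / (ℓ - m)) *
            eLpNorm ω (ENNReal.ofReal ℓ) (volume.restrict Omega) ^
              (1 - (m / 2) * (ℓ - 2) / (ℓ - m)) := by
  have hα : (m / 2) * (ℓ - 2) / (ℓ - m) ∈ Set.Ioo (0 : ℝ) 1 := by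
    have h0 : 0 < ℓ - m := by linarith
    refine ⟨div_pos (mul_pos (by linarith) (by linarith)) h0, ?_⟩
    rw [div_lt_one h0]
    nlinarith
  refine ⟨hα, ?_⟩
  obtain ⟨C, hC, hRiesz⟩ := exists_lintegral_div_norm_le hm hm2 hℓ
  refine ⟨6 * Real.pi ^ 2 * (C * 2), by have := Real.pi_pos; positivity, fun ω x => ?_⟩
  by_cases hmeas : AEStronglyMeasurable
      (fun y => ((enorm3 (x - y))⁻¹ ^ 3) • cross3 (x - y) (vortVec ω y)) volume
  swap
  · rw [biotSavart, integral_non_aestronglyMeasurable hmeas]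
    simp [enorm3]
  have hω := aemeasurable_of_biotSavart_integrand hmeas
  have hv := ofReal_enorm3_biotSavart_le hω x
  have hzero : ∀ p : ℝ, 0 < p → eLpNorm ω (ENNReal.ofReal p) (volume.restrict Omega) = 0 →
      ENNReal.ofReal (enorm3 (biotSavart ω x)) = 0 := by
    intro p hp h0
    rw [eLpNorm_eq_zero_iff hω.aestronglyMeasurable (by simpa using hp)] at h0
    have hint : ∫⁻ w in Omega, ‖ω w‖ₑ * ENNReal.ofReal ‖w - meridional x‖⁻¹ = 0 := by
      refine (lintegral_congr_ae ?_).trans lintegral_zero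
      filter_upwards [h0] with w hw
      simp [hw]
    simpa [hint] using hv
  have hRiesz' := hRiesz ω hω (meridional x)
  set A := eLpNorm ω (ENNReal.ofReal m) (volume.restrict Omega) with hAdef
  set B := eLpNorm ω (ENNReal.ofReal ℓ) (volume.restrict Omega) with hBdef
  by_cases hA0 : A = 0
  · rw [hzero m (by linarith) hA0]; exact zero_le
  by_cases hB0 : B = 0
  · rw [hzero ℓ (by linarith) hB0]; exact zero_le
  have hC0 : ENNReal.ofReal (6 * Real.pi ^ 2 * (C * 2)) ≠ 0 := by
    have := Real.pi_pos
    simpa using (by positivity : 0 < 6 * Real.pi ^ 2 * (C * 2))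
  have hα1 : 0 < 1 - (m / 2) * (ℓ - 2) / (ℓ - m) := by linarith [hα.2]
  by_cases hA : A = ⊤
  · rw [hA, ENNReal.top_rpow_of_pos hα.1, ENNReal.mul_top hC0, ENNReal.top_mul]
    · exact le_top
    · simpa [hB0] using fun _ => hα.2.le
  by_cases hB : B = ⊤
  · rw [hB, ENNReal.top_rpow_of_pos hα1, ENNReal.mul_top]
    · exact le_top
    · refine mul_ne_zero hC0 ?_
      simp [hA0, hα.1.le]
  refine hv.trans ((mul_le_mul_right
    (le_interpolation_of_forall_radius hm hm2 hℓ hA0 hA hB0 hB hRiesz') _).trans (le_of_eq ?_))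
  rw [ENNReal.ofReal_mul (q := C * 2) (by positivity), ENNReal.ofReal_mul hC.le,
    show ENNReal.ofReal 2 = 2 by simp]
  ring
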